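/- Suppose Φ is irreducible and simply laced, and let w ∈ W. Then w is commutative — equivalently, the inversion set Φ(w) contains no pair α, β with α + β ∈ Φ(w) — if and only if 𝔞_w = ⊕_{α∈Φ(w)} 𝔤_α is a spherical subspace of 𝔫, i.e. ad(x)⁴ = 0 for every x ∈ 𝔞_w. -/

import Mathlib

/- Background setup: a finite reduced crystallographic root system `Φ` with chosen
positive roots `Φ⁺` in a euclidean space `V`, the Cartan pairing, and the basic
combinatorial notions used in the statement. -/

open scoped RealInnerProductSpace

noncomputable section

variable {V : Type*} [NormedAddCommGroup V] [InnerProductSpace ℝ V]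

/-- The Cartan pairing `⟨α, β⟩ = 2 (α, β) / (β, β)`. -/
def cpair (α β : V) : ℝ := 2 * ⟪α, β⟫ / ⟪β, β⟫

/-- The reflection associated to `β`, as a linear endomorphism of `V`:
`v ↦ v - (2 (β, v)/(β, β)) • β`. -/
def reflEnd (β : V) : Module.End ℝ V :=
  LinearMap.id -
    (LinearMap.toSpanSingleton ℝ V β ∘ₗ ((2 / ⟪β, β⟫) • (innerSL ℝ β).toLinearMap))

/-- A subset of `V` is orthogonal if the Cartan pairing of any two distinct
elements vanishes. -/
def OrthogonalSet (S : Set V) : Prop := ∀ γ ∈ S, ∀ γ' ∈ S, γ ≠ γ' → cpair γ γ' = 0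

/-- A finite reduced crystallographic root system in the euclidean space `V`,
together with a choice of positive roots. -/
structure RootSystemData (V : Type*) [NormedAddCommGroup V] [InnerProductSpace ℝ V] where
  /-- the set of roots Φ -/
  roots : Set V
  /-- the set of positive roots Φ⁺ -/
  pos : Set V
  finite : roots.Finite
  ne_zero : ∀ α ∈ roots, α ≠ 0
  span_eq_top : Submodule.span ℝ roots = ⊤
  reduced : ∀ α ∈ roots, ∀ t : ℝ, t • α ∈ roots → t = 1 ∨ t = -1
  crystallographic : ∀ α ∈ roots, ∀ β ∈ roots, ∃ n : ℤ, cpair α β = (n : ℝ)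
  reflect_mem : ∀ α ∈ roots, ∀ β ∈ roots, reflEnd β α ∈ roots
  pos_subset : pos ⊆ roots
  pos_iff : ∀ α ∈ roots, (α ∈ pos ↔ ¬ (-α ∈ pos))
  pos_add : ∀ α ∈ pos, ∀ β ∈ pos, α + β ∈ roots → α + β ∈ pos

namespace RootSystemData

variable (D : RootSystemData V)

/-- Irreducibility: the roots admit no nontrivial partition into two mutually
orthogonal parts. -/
def IsIrreducible : Prop :=
  D.roots.Nonempty ∧
    ∀ s ⊆ D.roots, (∀ α ∈ s, ∀ β ∈ D.roots \ s, ⟪α, β⟫ = 0) → s = ∅ ∨ s = D.roots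

/-- An irreducible root system is not of type `G₂` iff no Cartan pairing of two
roots equals `±3`. -/
def NotG2 : Prop := ∀ α ∈ D.roots, ∀ β ∈ D.roots, cpair α β ≠ 3 ∧ cpair α β ≠ -3

/-- An irreducible root system is of type `G₂` iff some Cartan pairing of two
roots equals `±3`. -/
def IsG2 : Prop :=
  D.IsIrreducible ∧ ∃ α ∈ D.roots, ∃ β ∈ D.roots, cpair α β = 3 ∨ cpair α β = -3

/-- All roots have the same length (types A, D, E). -/
def SimplyLaced : Prop := ∀ α ∈ D.roots, ∀ β ∈ D.roots, ⟪α, α⟫ = ⟪β, β⟫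

/-- There are exactly two root lengths, with squared-length ratio 2
(types B, C, F₄). -/
def DoublyLaced : Prop :=
  (∃ α ∈ D.roots, ∃ β ∈ D.roots, ⟪β, β⟫ = 2 * ⟪α, α⟫) ∧
    ∀ α ∈ D.roots, ∀ β ∈ D.roots,
      ⟪α, α⟫ = ⟪β, β⟫ ∨ ⟪β, β⟫ = 2 * ⟪α, α⟫ ∨ ⟪α, α⟫ = 2 * ⟪β, β⟫

/-- A root of maximal length. -/
def IsLong (α : V) : Prop := α ∈ D.roots ∧ ∀ β ∈ D.roots, ⟪β, β⟫ ≤ ⟪α, α⟫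

/-- A root of minimal length. -/
def IsShort (α : V) : Prop := α ∈ D.roots ∧ ∀ β ∈ D.roots, ⟪α, α⟫ ≤ ⟪β, β⟫

/-- A set of positive roots is convex if any root which is a linear combination of
two of its elements with positive coefficients lies in it. -/
def ConvexSubset (S : Set V) : Prop :=
  ∀ α ∈ S, ∀ β ∈ S, ∀ a b : ℝ, 0 < a → 0 < b →
    a • α + b • β ∈ D.roots → a • α + b • β ∈ S

/-- A subset `Ψ ⊆ Φ⁺` is biconvex if both `Ψ` and `Φ⁺ \ Ψ` are convex. -/
def Biconvex (S : Set V) : Prop :=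
  S ⊆ D.pos ∧ D.ConvexSubset S ∧ D.ConvexSubset (D.pos \ S)

/-- A subset `Ψ ⊆ Φ⁺` is a combinatorial ideal if `α ∈ Ψ`, `β ∈ Φ⁺`, `α + β ∈ Φ⁺`
imply `α + β ∈ Ψ`. -/
def CombIdeal (S : Set V) : Prop :=
  S ⊆ D.pos ∧ ∀ α ∈ S, ∀ β ∈ D.pos, α + β ∈ D.pos → α + β ∈ S

end RootSystemData

/- The Weyl group: words in the simple reflections, reduced expressions, length,
inversion sets, and the (fully) commutative elements. -/

/-- The product of the reflections attached to a word (a list of roots). -/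
def wordProd (l : List V) : Module.End ℝ V := (l.map reflEnd).prod

/-- The alternating word `[α, β, α, β, ...]` of length `n`. -/
def altWord (α β : V) : ℕ → List V
  | 0 => []
  | n + 1 => α :: altWord β α n

namespace RootSystemData

variable (D : RootSystemData V)

/-- The simple roots: the positive roots which are not sums of two positive
roots. -/
def simpleRoots : Set V :=
  {α | α ∈ D.pos ∧ ¬ ∃ β ∈ D.pos, ∃ γ ∈ D.pos, α = β + γ}

/-- A word in the simple reflections, encoded as a list of simple roots. -/
def IsWord (l : List V) : Prop := ∀ α ∈ l, α ∈ D.simpleRoots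

/-- Membership in the Weyl group: `w` is a product of simple reflections. -/
def InWeyl (w : Module.End ℝ V) : Prop := ∃ l : List V, D.IsWord l ∧ wordProd l = w

/-- A reduced word: a word of minimal length among all words with the same
product. -/
def IsReducedWord (l : List V) : Prop :=
  D.IsWord l ∧
    ∀ l' : List V, D.IsWord l' → wordProd l' = wordProd l → l.length ≤ l'.length

/-- The length of a Weyl group element. -/
noncomputable def len (w : Module.End ℝ V) : ℕ :=
  sInf {n | ∃ l : List V, D.IsWord l ∧ wordProd l = w ∧ l.length = n}

/-- The inversion set `Φ(w) = {α ∈ Φ⁺ | w(α) ∈ Φ⁻}`. -/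
def inversions (w : Module.End ℝ V) : Set V :=
  {α | α ∈ D.pos ∧ w α ∈ D.roots ∧ w α ∉ D.pos}

/-- `w` is fully commutative: no reduced expression for `w` contains a contiguous
substring `s_α s_β s_α s_β ⋯` of length `m(s_α, s_β)`, where `s_α, s_β` are
non-commuting simple reflections and `m(s_α, s_β)` is the order of `s_α s_β`. -/
def FullyCommutative (w : Module.End ℝ V) : Prop :=
  D.InWeyl w ∧
    ∀ l : List V, D.IsReducedWord l → wordProd l = w →
      ∀ α ∈ D.simpleRoots, ∀ β ∈ D.simpleRoots,
        ¬ Commute (reflEnd α) (reflEnd β) →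
          ¬ (altWord α β (orderOf (reflEnd α * reflEnd β)) <:+: l)

/-- `w` is commutative: no reduced expression for `w` contains a substring
`s_α s_β s_α` with `α, β` simple and `‖α‖ ≤ ‖β‖`. -/
def Commutative (w : Module.End ℝ V) : Prop :=
  D.InWeyl w ∧
    ∀ l : List V, D.IsReducedWord l → wordProd l = w →
      ∀ α ∈ D.simpleRoots, ∀ β ∈ D.simpleRoots, ‖α‖ ≤ ‖β‖ →
        ¬ ([α, β, α] <:+: l)

end RootSystemData

/- The Lie-theoretic setup: a finite-dimensional complex simple Lie algebra `𝔤`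
with Cartan subalgebra `𝔱`, whose root space decomposition is indexed by the
root system `Φ ⊆ V`. -/

/-- A finite-dimensional simple complex Lie algebra `L`, together with a Cartan
subalgebra and its root space decomposition, whose root system is `Φ ⊆ V` with a
choice of positive roots (determining the Borel subalgebra `𝔟 = 𝔱 ⊕ 𝔫`). -/
structure LieRootData (V : Type*) [NormedAddCommGroup V] [InnerProductSpace ℝ V]
    (L : Type*) [LieRing L] [LieAlgebra ℂ L] extends RootSystemData V where
  /-- the Cartan subalgebra 𝔱 -/
  cartan : LieSubalgebra ℂ L
  /-- the root space 𝔤_α attached to each root α -/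
  rs : V → Submodule ℂ L
  finiteDim : FiniteDimensional ℂ L
  isSimple : LieAlgebra.IsSimple ℂ L
  isCartan : cartan.IsCartanSubalgebra
  rs_dim : ∀ α ∈ roots, Module.finrank ℂ (rs α) = 1
  sup_eq_top : cartan.toSubmodule ⊔ (⨆ α ∈ roots, rs α) = ⊤
  indep : ∀ α ∈ roots, rs α ⊓ (cartan.toSubmodule ⊔ ⨆ β ∈ roots \ {α}, rs β) = ⊥
  weight_vec : ∀ α ∈ roots, ∀ h ∈ cartan, ∀ x ∈ rs α, ∃ c : ℂ, ⁅h, x⁆ = c • x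
  bracket_mem : ∀ α ∈ roots, ∀ β ∈ roots, α + β ∈ roots →
    ∀ x ∈ rs α, ∀ y ∈ rs β, ⁅x, y⁆ ∈ rs (α + β)
  bracket_ne_zero : ∀ α ∈ roots, ∀ β ∈ roots, α + β ∈ roots →
    ∀ x ∈ rs α, x ≠ 0 → ∀ y ∈ rs β, y ≠ 0 → ⁅x, y⁆ ≠ 0
  bracket_eq_zero : ∀ α ∈ roots, ∀ β ∈ roots, α + β ∉ roots → α + β ≠ 0 →
    ∀ x ∈ rs α, ∀ y ∈ rs β, ⁅x, y⁆ = 0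
  bracket_cartan_mem : ∀ α ∈ roots, ∀ x ∈ rs α, ∀ y ∈ rs (-α), ⁅x, y⁆ ∈ cartan

namespace LieRootData

variable {L : Type*} [LieRing L] [LieAlgebra ℂ L] (D : LieRootData V L)

/-- The nilradical `𝔫 = ⊕_{α ∈ Φ⁺} 𝔤_α` of the Borel subalgebra, as a submodule. -/
def nilrad : Submodule ℂ L := ⨆ α ∈ D.pos, D.rs α

/-- The Borel subalgebra `𝔟 = 𝔱 ⊕ 𝔫`, as a submodule. -/
def borel : Submodule ℂ L := D.cartan.toSubmodule ⊔ D.nilrad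

/-- The subspace `𝔞_Ψ = ⊕_{α ∈ Ψ} 𝔤_α` attached to a subset `Ψ ⊆ Φ⁺`. -/
def aSubspace (S : Set V) : Submodule ℂ L := ⨆ α ∈ S, D.rs α

end LieRootData

/-- A subspace of `𝔫` is spherical if `ad(x)^4 = 0` for every `x` in it. -/
def IsSphericalSubspace {L : Type*} [LieRing L] [LieAlgebra ℂ L]
    (a : Submodule ℂ L) : Prop :=
  ∀ x ∈ a, (LieAlgebra.ad ℂ L x) ^ 4 = 0

/-- The height of a nilpotent element `x`: `max {n | ad(x)^n ≠ 0}`. -/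
noncomputable def heightOf {L : Type*} [LieRing L] [LieAlgebra ℂ L] (x : L) : ℕ :=
  sSup {n : ℕ | (LieAlgebra.ad ℂ L x) ^ n ≠ 0}

/-! ### Elementary facts on reflections -/

lemma reflEnd_apply (β v : V) : reflEnd β v = v - (2 / ⟪β, β⟫ * ⟪β, v⟫) • β := by
  simp [reflEnd]

/-- Rescaled inner product. -/
def bil (N : ℝ) (α β : V) : ℝ := 2 * ⟪α, β⟫ / N

lemma bil_comm (N : ℝ) (α β : V) : bil N α β = bil N β α := by
  simp [bil, real_inner_comm]

lemma bil_add_left (N : ℝ) (α β γ : V) : bil N (α + β) γ = bil N α γ + bil N β γ := by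
  simp [bil, inner_add_left]; ring

lemma bil_add_right (N : ℝ) (α β γ : V) : bil N α (β + γ) = bil N α β + bil N α γ := by
  simp [bil, inner_add_right]; ring

lemma bil_neg_left (N : ℝ) (α β : V) : bil N (-α) β = -bil N α β := by
  simp [bil]; ring

lemma bil_neg_right (N : ℝ) (α β : V) : bil N α (-β) = -bil N α β := by
  simp [bil]; ring

lemma bil_sub_left (N : ℝ) (α β γ : V) : bil N (α - β) γ = bil N α γ - bil N β γ := by
  simp [bil, inner_sub_left]; ring

lemma bil_sub_right (N : ℝ) (α β γ : V) : bil N α (β - γ) = bil N α β - bil N α γ := by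
  simp [bil, inner_sub_right]; ring

lemma bil_self_eq_zero {N : ℝ} (hN : 0 < N) {v : V} (h : bil N v v = 0) : v = 0 := by
  unfold bil at h
  have h2 : ⟪v, v⟫ = 0 := by
    field_simp at h
    linarith
  simpa using h2

lemma reflEnd_inner {β : V} (hβ : β ≠ 0) (x y : V) : ⟪reflEnd β x, reflEnd β y⟫ = ⟪x, y⟫ := by
  have h : ⟪β, β⟫ ≠ 0 := by simpa using hβ
  rw [reflEnd_apply, reflEnd_apply]
  simp only [inner_sub_left, inner_sub_right, inner_smul_left, inner_smul_right]
  rw [real_inner_comm β x]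
  simp only [RCLike.conj_to_real]
  field_simp
  ring

lemma reflEnd_mul_self {β : V} (hβ : β ≠ 0) : reflEnd β * reflEnd β = 1 := by
  have h : ⟪β, β⟫ ≠ 0 := by simpa using hβ
  ext x
  simp only [Module.End.mul_apply, reflEnd_apply, inner_sub_right, inner_smul_right,
    Module.End.one_apply]
  have : 2 / ⟪β, β⟫ * (⟪β, x⟫ - 2 / ⟪β, β⟫ * ⟪β, x⟫ * ⟪β, β⟫) = - (2 / ⟪β, β⟫ * ⟪β, x⟫) := by
    field_simp
    ring
  rw [this]
  simp

lemma reflEnd_self {β : V} (hβ : β ≠ 0) : reflEnd β β = -β := by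
  have h : ⟪β, β⟫ ≠ 0 := by simpa using hβ
  rw [reflEnd_apply, div_mul_cancel₀ _ h, two_smul]
  abel

lemma reflEnd_neg (β : V) : reflEnd (-β) = reflEnd β := by
  ext x
  simp [reflEnd_apply]

lemma wordProd_nil : wordProd ([] : List V) = 1 := rfl

lemma wordProd_cons (a : V) (l : List V) : wordProd (a :: l) = reflEnd a * wordProd l := by
  simp [wordProd]

lemma wordProd_append (l l' : List V) : wordProd (l ++ l') = wordProd l * wordProd l' := by
  simp [wordProd]

lemma wordProd_singleton (a : V) : wordProd [a] = reflEnd a := by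
  simp [wordProd]

namespace RootSystemData

section comb

variable (D : RootSystemData V)

lemma simple_pos {a : V} (ha : a ∈ D.simpleRoots) : a ∈ D.pos := ha.1
lemma simple_root {a : V} (ha : a ∈ D.simpleRoots) : a ∈ D.roots := D.pos_subset ha.1
lemma simple_ne {a : V} (ha : a ∈ D.simpleRoots) : a ≠ 0 := D.ne_zero _ (D.simple_root ha)

lemma neg_mem {α : V} (h : α ∈ D.roots) : -α ∈ D.roots := by
  have := D.reflect_mem α h α h
  rwa [reflEnd_self (D.ne_zero _ h)] at this

lemma not_pos_iff {α : V} (h : α ∈ D.roots) : α ∉ D.pos ↔ -α ∈ D.pos := by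
  have := D.pos_iff α h
  tauto

lemma isWord_append {l l' : List V} : D.IsWord (l ++ l') ↔ D.IsWord l ∧ D.IsWord l' := by
  simp only [IsWord, List.mem_append]
  constructor
  · intro h
    exact ⟨fun a ha => h a (Or.inl ha), fun a ha => h a (Or.inr ha)⟩
  · rintro ⟨h1, h2⟩ a (ha | ha)
    · exact h1 a ha
    · exact h2 a ha

lemma isWord_cons {a : V} {l : List V} : D.IsWord (a :: l) ↔ a ∈ D.simpleRoots ∧ D.IsWord l := by
  simp [IsWord]

lemma isWord_reverse {l : List V} : D.IsWord l.reverse ↔ D.IsWord l := by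
  simp [IsWord]

lemma isWord_nil : D.IsWord ([] : List V) := by
  simp [IsWord]

lemma wordProd_mem {l : List V} (hl : D.IsWord l) {α : V} (hα : α ∈ D.roots) :
    wordProd l α ∈ D.roots := by
  induction l with
  | nil => simpa [wordProd_nil] using hα
  | cons a l ih =>
    rw [D.isWord_cons] at hl
    rw [wordProd_cons]
    exact D.reflect_mem _ (ih hl.2) _ (D.simple_root hl.1)

lemma wordProd_inner {l : List V} (hl : D.IsWord l) (x y : V) :
    ⟪wordProd l x, wordProd l y⟫ = ⟪x, y⟫ := by
  induction l with
  | nil => simp [wordProd_nil]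
  | cons a l ih =>
    rw [D.isWord_cons] at hl
    rw [wordProd_cons, Module.End.mul_apply, Module.End.mul_apply,
      reflEnd_inner (D.simple_ne hl.1), ih hl.2]

lemma wordProd_reverse {l : List V} (hl : D.IsWord l) :
    wordProd l * wordProd l.reverse = 1 := by
  induction l with
  | nil => simp [wordProd_nil]
  | cons a l ih =>
    rw [D.isWord_cons] at hl
    rw [wordProd_cons, List.reverse_cons, wordProd_append, wordProd_singleton, mul_assoc,
      ← mul_assoc (wordProd l), ih hl.2, one_mul, reflEnd_mul_self (D.simple_ne hl.1)]

lemma wordProd_reverse' {l : List V} (hl : D.IsWord l) :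
    wordProd l.reverse * wordProd l = 1 := by
  have := D.wordProd_reverse (D.isWord_reverse.2 hl)
  simpa using this

lemma wordProd_conj {l : List V} (hl : D.IsWord l) (c : V) :
    wordProd l * reflEnd c = reflEnd (wordProd l c) * wordProd l := by
  ext x
  simp only [Module.End.mul_apply, reflEnd_apply, D.wordProd_inner hl, map_sub, map_smul]

lemma mem_inversions {l : List V} (hl : D.IsWord l) {α : V} :
    α ∈ D.inversions (wordProd l) ↔ α ∈ D.pos ∧ wordProd l α ∉ D.pos := by
  simp only [inversions, Set.mem_ofPred_eq]
  constructor
  · rintro ⟨h1, h2, h3⟩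
    exact ⟨h1, h3⟩
  · rintro ⟨h1, h2⟩
    exact ⟨h1, D.wordProd_mem hl (D.pos_subset h1), h2⟩

lemma inversions_add {l : List V} (hl : D.IsWord l) {α β : V}
    (hα : α ∈ D.inversions (wordProd l)) (hβ : β ∈ D.inversions (wordProd l))
    (h : α + β ∈ D.roots) : α + β ∈ D.inversions (wordProd l) := by
  have hr := D.wordProd_mem hl h
  rw [D.mem_inversions hl]
  refine ⟨D.pos_add _ hα.1 _ hβ.1 h, ?_⟩
  rw [D.not_pos_iff hr]
  have h1 := (D.not_pos_iff hα.2.1).1 hα.2.2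
  have h2 := (D.not_pos_iff hβ.2.1).1 hβ.2.2
  have h3 : -(wordProd l (α + β)) = -wordProd l α + -wordProd l β := by
    rw [map_add]; abel
  rw [h3]
  refine D.pos_add _ h1 _ h2 ?_
  rw [← h3]
  exact D.neg_mem hr

/-- All roots have the same squared length `N`. -/
def HasNorm (N : ℝ) : Prop := 0 < N ∧ ∀ α ∈ D.roots, ⟪α, α⟫ = N

variable {D} {N : ℝ}

lemma bil_self (hN : D.HasNorm N) {α : V} (h : α ∈ D.roots) : bil N α α = 2 := by
  have := hN.1
  rw [bil, hN.2 α h]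
  field_simp

lemma refl_bil (hN : D.HasNorm N) {β : V} (h : β ∈ D.roots) (v : V) :
    reflEnd β v = v - bil N v β • β := by
  rw [reflEnd_apply, hN.2 β h, bil, real_inner_comm]
  congr 2
  ring

lemma wordProd_bil {l : List V} (hl : D.IsWord l) (x y : V) :
    bil N (wordProd l x) (wordProd l y) = bil N x y := by
  simp [bil, D.wordProd_inner hl]

lemma bil_cases (hN : D.HasNorm N) {α β : V} (hα : α ∈ D.roots) (hβ : β ∈ D.roots) :
    (α = β ∧ bil N α β = 2) ∨ (α = -β ∧ bil N α β = -2) ∨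
      bil N α β = -1 ∨ bil N α β = 0 ∨ bil N α β = 1 := by
  obtain ⟨n, hn⟩ := D.crystallographic α hα β hβ
  have hb : bil N α β = n := by rw [← hn, cpair, bil, hN.2 β hβ]
  have hs : bil N (α - β) (α - β) = 4 - 2 * n := by
    simp only [bil_sub_left, bil_sub_right, bil_self hN hα, bil_self hN hβ, bil_comm N β α, hb]
    ring
  have ha : bil N (α + β) (α + β) = 4 + 2 * n := by
    simp only [bil_add_left, bil_add_right, bil_self hN hα, bil_self hN hβ, bil_comm N β α, hb]
    ring
  have hnn : ∀ v : V, 0 ≤ bil N v v := fun v =>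
    div_nonneg (mul_nonneg zero_le_two real_inner_self_nonneg) hN.1.le
  have h1 : (n : ℝ) ≤ 2 := by
    have := hnn (α - β); linarith
  have h2 : (-2 : ℝ) ≤ n := by
    have := hnn (α + β); linarith
  have h1' : n ≤ 2 := by exact_mod_cast h1
  have h2' : -2 ≤ n := by exact_mod_cast h2
  have : n = -2 ∨ n = -1 ∨ n = 0 ∨ n = 1 ∨ n = 2 := by omega
  rcases this with rfl | rfl | rfl | rfl | rfl
  · right; left
    refine ⟨?_, by simpa using hb⟩
    have : α + β = 0 := bil_self_eq_zero hN.1 (by rw [ha]; norm_num)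
    exact eq_neg_of_add_eq_zero_left this
  · right; right; left; simpa using hb
  · right; right; right; left; simpa using hb
  · right; right; right; right; simpa using hb
  · left
    refine ⟨?_, by simpa using hb⟩
    have : α - β = 0 := bil_self_eq_zero hN.1 (by rw [hs]; norm_num)
    exact sub_eq_zero.1 this

lemma add_root (hN : D.HasNorm N) {α β : V} (hα : α ∈ D.roots) (hβ : β ∈ D.roots)
    (h : bil N α β = -1) : α + β ∈ D.roots := by
  have := D.reflect_mem α hα β hβ
  rw [refl_bil hN hβ, h] at this
  simpa using this

lemma sub_root (hN : D.HasNorm N) {α β : V} (hα : α ∈ D.roots) (hβ : β ∈ D.roots)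
    (h : bil N α β = 1) : α - β ∈ D.roots := by
  have := D.reflect_mem α hα β hβ
  rw [refl_bil hN hβ, h] at this
  simpa using this

lemma bil_of_add_root (hN : D.HasNorm N) {α β : V} (hα : α ∈ D.roots) (hβ : β ∈ D.roots)
    (h : α + β ∈ D.roots) : bil N α β = -1 := by
  have := bil_self hN h
  simp only [bil_add_left, bil_add_right, bil_self hN hα, bil_self hN hβ, bil_comm N β α] at this
  linarith

/-- A simple reflection permutes the positive roots other than the simple root. -/
lemma simple_refl_pos (hN : D.HasNorm N) {a β : V} (ha : a ∈ D.simpleRoots) (hβ : β ∈ D.pos)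
    (hne : β ≠ a) : reflEnd a β ∈ D.pos := by
  have har := D.simple_root ha
  have hβr := D.pos_subset hβ
  have hmem := D.reflect_mem β hβr a har
  rw [refl_bil hN har] at hmem ⊢
  rcases bil_cases hN hβr har with ⟨h, _⟩ | ⟨h, _⟩ | h | h | h
  · exact absurd h hne
  · exfalso
    have := (D.pos_iff a har).1 ha.1
    rw [h] at hβ
    exact this hβ
  · rw [h] at hmem ⊢
    simp only [neg_smul, one_smul, sub_neg_eq_add] at hmem ⊢
    exact D.pos_add _ hβ _ ha.1 hmem
  · rw [h]; simpa using hβ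
  · rw [h] at hmem ⊢
    simp only [one_smul] at hmem ⊢
    by_contra hcon
    rw [D.not_pos_iff hmem] at hcon
    exact ha.2 ⟨β, hβ, _, hcon, by abel⟩

lemma simple_bil (hN : D.HasNorm N) {a b : V} (ha : a ∈ D.simpleRoots) (hb : b ∈ D.simpleRoots)
    (hne : a ≠ b) : bil N a b = 0 ∨ bil N a b = -1 := by
  have har := D.simple_root ha
  have hbr := D.simple_root hb
  rcases bil_cases hN har hbr with ⟨h, _⟩ | ⟨h, _⟩ | h | h | h
  · exact absurd h hne
  · exfalso
    have := (D.pos_iff b hbr).1 hb.1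
    have h2 := ha.1
    rw [h] at h2
    exact this h2
  · exact Or.inr h
  · exact Or.inl h
  · exfalso
    have hmem := sub_root hN har hbr h
    by_cases hp : a - b ∈ D.pos
    · exact ha.2 ⟨b, hb.1, _, hp, by abel⟩
    · rw [D.not_pos_iff hmem] at hp
      exact hb.2 ⟨a, ha.1, _, hp, by abel⟩

/-- Exchange condition. -/
lemma exchange (hN : D.HasNorm N) {l : List V} (hl : D.IsWord l) {c : V} (hc : c ∈ D.pos)
    (h : wordProd l c ∉ D.pos) :
    ∃ l', D.IsWord l' ∧ l'.length + 1 = l.length ∧ wordProd l' = wordProd l * reflEnd c := by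
  induction l with
  | nil => exact absurd hc (by simpa [wordProd_nil] using h)
  | cons d u ih =>
    rw [D.isWord_cons] at hl
    by_cases hu : wordProd u c ∈ D.pos
    · have hd : wordProd u c = d := by
        by_contra hne
        exact h (by rw [wordProd_cons]; exact simple_refl_pos hN hl.1 hu hne)
      refine ⟨u, hl.2, by simp, ?_⟩
      rw [wordProd_cons, mul_assoc, D.wordProd_conj hl.2, hd, ← mul_assoc,
        reflEnd_mul_self (D.simple_ne hl.1), one_mul]
    · obtain ⟨l', h1, h2, h3⟩ := ih hl.2 hu
      refine ⟨d :: l', D.isWord_cons.2 ⟨hl.1, h1⟩, by simp [h2], ?_⟩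
      rw [wordProd_cons, wordProd_cons, h3, mul_assoc]

lemma reduced_left {u v : List V} (h : D.IsReducedWord (u ++ v)) : D.IsReducedWord u := by
  obtain ⟨h1, h2⟩ := h
  rw [D.isWord_append] at h1
  refine ⟨h1.1, fun l' hl' he => ?_⟩
  have := h2 (l' ++ v) (D.isWord_append.2 ⟨hl', h1.2⟩) (by rw [wordProd_append, wordProd_append, he])
  simpa using this

lemma reduced_right {u v : List V} (h : D.IsReducedWord (u ++ v)) : D.IsReducedWord v := by
  obtain ⟨h1, h2⟩ := h
  rw [D.isWord_append] at h1
  refine ⟨h1.2, fun l' hl' he => ?_⟩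
  have := h2 (u ++ l') (D.isWord_append.2 ⟨h1.1, hl'⟩) (by rw [wordProd_append, wordProd_append, he])
  simpa using this

lemma reverse_congr {l l' : List V} (hl : D.IsWord l) (hl' : D.IsWord l')
    (h : wordProd l = wordProd l') : wordProd l.reverse = wordProd l'.reverse := by
  have h1 := D.wordProd_reverse' hl
  have h2 := D.wordProd_reverse hl'
  calc wordProd l.reverse = wordProd l.reverse * (wordProd l' * wordProd l'.reverse) := by
        rw [h2, mul_one]
    _ = wordProd l'.reverse := by rw [← mul_assoc, ← h, h1, one_mul]

lemma reduced_reverse {l : List V} (h : D.IsReducedWord l) : D.IsReducedWord l.reverse := by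
  refine ⟨D.isWord_reverse.2 h.1, fun l' hl' he => ?_⟩
  have := h.2 l'.reverse (D.isWord_reverse.2 hl') (by
    have := reverse_congr hl' (D.isWord_reverse.2 h.1) he
    simpa using this)
  simpa using this

lemma reduced_exists {l : List V} (hl : D.IsWord l) :
    ∃ l', D.IsReducedWord l' ∧ wordProd l' = wordProd l := by
  classical
  have hex : ∃ n, ∃ l', D.IsWord l' ∧ wordProd l' = wordProd l ∧ l'.length = n :=
    ⟨_, l, hl, rfl, rfl⟩
  obtain ⟨l', h1, h2, h3⟩ := Nat.find_spec hex
  refine ⟨l', ⟨h1, fun l'' h4 h5 => ?_⟩, h2⟩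
  rw [h3]
  exact Nat.find_min' hex ⟨l'', h4, h5.trans h2, rfl⟩

lemma reduced_last_pos (hN : D.HasNorm N) {l : List V} {c : V} (h : D.IsReducedWord (l ++ [c])) :
    wordProd l c ∈ D.pos := by
  have h1 := D.isWord_append.1 h.1
  have hc : c ∈ D.simpleRoots := h1.2 c (by simp)
  by_contra hcon
  obtain ⟨l', h2, h3, h4⟩ := exchange hN h1.1 hc.1 hcon
  have := h.2 l' h2 (by rw [h4, wordProd_append, wordProd_singleton])
  simp at this
  omega

lemma reduced_inversion (hN : D.HasNorm N) {u v : List V} {c : V}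
    (h : D.IsReducedWord (u ++ c :: v)) :
    wordProd v.reverse c ∈ D.inversions (wordProd (u ++ c :: v)) := by
  have hw := D.isWord_append.1 h.1
  have hw2 := D.isWord_cons.1 hw.2
  have h1 : wordProd u c ∈ D.pos := by
    apply reduced_last_pos hN
    apply reduced_left (v := v)
    simpa using h
  have h2 : wordProd v.reverse c ∈ D.pos := by
    apply reduced_last_pos hN
    have := reduced_reverse (reduced_right h)
    simpa using this
  rw [D.mem_inversions h.1]
  refine ⟨h2, ?_⟩
  have : wordProd (u ++ c :: v) (wordProd v.reverse c) = - wordProd u c := by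
    rw [wordProd_append, wordProd_cons, ← Module.End.mul_apply, mul_assoc, mul_assoc,
      D.wordProd_reverse hw2.2, mul_one, Module.End.mul_apply, reflEnd_self (D.simple_ne hw2.1),
      map_neg]
  rw [this]
  exact (D.pos_iff _ (D.pos_subset h1)).1 h1

lemma descent (hN : D.HasNorm N) {l : List V} (h : D.IsReducedWord l) {c : V}
    (hc : c ∈ D.simpleRoots) (hi : c ∈ D.inversions (wordProd l)) :
    ∃ l', D.IsReducedWord (l' ++ [c]) ∧ wordProd (l' ++ [c]) = wordProd l ∧
      l'.length + 1 = l.length ∧ wordProd l' = wordProd l * reflEnd c := by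
  obtain ⟨l', h1, h2, h3⟩ := exchange hN h.1 hc.1 hi.2.2
  have he : wordProd (l' ++ [c]) = wordProd l := by
    rw [wordProd_append, wordProd_singleton, h3, mul_assoc, reflEnd_mul_self (D.simple_ne hc),
      mul_one]
  refine ⟨l', ⟨D.isWord_append.2 ⟨h1, by simpa [IsWord] using hc⟩, fun l'' h4 h5 => ?_⟩, he, h2, h3⟩
  have := h.2 l'' h4 (h5.trans he)
  simp
  omega

lemma exists_descent (hN : D.HasNorm N) {l : List V} (h : D.IsReducedWord l)
    {β : V} (hβ : β ∈ D.inversions (wordProd l)) :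
    ∃ c ∈ D.simpleRoots, c ∈ D.inversions (wordProd l) := by
  rcases List.eq_nil_or_concat l with rfl | ⟨u, c, rfl⟩
  · exact absurd hβ.1 (by simpa [wordProd_nil] using hβ.2.2)
  · rw [List.concat_eq_append] at h hβ ⊢
    refine ⟨c, (D.isWord_append.1 h.1).2 c (by simp), ?_⟩
    have := reduced_inversion hN (v := []) h
    simpa [wordProd_nil] using this

end comb

end RootSystemData

namespace RootSystemData

section comb2

variable {D : RootSystemData V} {N : ℝ}

lemma inv_refl (hN : D.HasNorm N) {l l' : List V} (hl : D.IsWord l) (hl' : D.IsWord l') {c : V}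
    (hc : c ∈ D.simpleRoots) (h : wordProd l' = wordProd l * reflEnd c) {α : V}
    (hα : α ∈ D.inversions (wordProd l)) (hne : α ≠ c) :
    reflEnd c α ∈ D.inversions (wordProd l') := by
  rw [D.mem_inversions hl']
  refine ⟨simple_refl_pos hN hc hα.1 hne, ?_⟩
  rw [h, ← Module.End.mul_apply, mul_assoc, reflEnd_mul_self (D.simple_ne hc), mul_one]
  exact hα.2.2

lemma sum_pattern (hN : D.HasNorm N) : ∀ (n : ℕ) (l : List V), l.length = n → D.IsReducedWord l →
    ∀ α β, α ∈ D.inversions (wordProd l) → β ∈ D.inversions (wordProd l) → α + β ∈ D.roots →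
    ∃ l', D.IsReducedWord l' ∧ wordProd l' = wordProd l ∧
      ∃ a ∈ D.simpleRoots, ∃ b ∈ D.simpleRoots, [a, b, a] <:+: l' := by
  intro n
  induction n using Nat.strong_induction_on with
  | _ n ih =>
  intro l hln hl
  have step : ∀ c ∈ D.simpleRoots, c ∈ D.inversions (wordProd l) → ∀ α β,
      α ∈ D.inversions (wordProd l) → β ∈ D.inversions (wordProd l) → α + β ∈ D.roots →
      c ≠ α → c ≠ β → ∃ l', D.IsReducedWord l' ∧ wordProd l' = wordProd l ∧
      ∃ a ∈ D.simpleRoots, ∃ b ∈ D.simpleRoots, [a, b, a] <:+: l' := by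
    intro c hc hci α β hα hβ hαβ hcα hcβ
    obtain ⟨l', h1, h2, h3, h4⟩ := descent hN hl hc hci
    have hr := reduced_left h1
    obtain ⟨l'', h5, h6, a, ha, b, hb, hab⟩ := ih l'.length (by omega) l' rfl hr _ _
      (inv_refl hN hl.1 hr.1 hc h4 hα hcα.symm) (inv_refl hN hl.1 hr.1 hc h4 hβ hcβ.symm)
      (by rw [← map_add]; exact D.reflect_mem _ hαβ _ (D.simple_root hc))
    have he : wordProd (l'' ++ [c]) = wordProd l := by
      rw [wordProd_append, h6, ← wordProd_append, h2]
    refine ⟨l'' ++ [c], ⟨D.isWord_append.2 ⟨h5.1, (D.isWord_append.1 h1.1).2⟩, ?_⟩, he,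
      a, ha, b, hb, hab.trans (List.prefix_append _ _).isInfix⟩
    intro m hm hme
    have i1 := hl.2 m hm (hme.trans he)
    have i2 := h5.2 l' hr.1 h6.symm
    simp
    omega
  have key : ∀ α β, α ∈ D.inversions (wordProd l) → β ∈ D.inversions (wordProd l) →
      α + β ∈ D.roots → α ∈ D.simpleRoots → ∃ l', D.IsReducedWord l' ∧ wordProd l' = wordProd l ∧
      ∃ a ∈ D.simpleRoots, ∃ b ∈ D.simpleRoots, [a, b, a] <:+: l' := by
    intro α β hα hβ hαβ hs
    have hαr := D.pos_subset hα.1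
    have hβr := D.pos_subset hβ.1
    have hb := bil_of_add_root hN hαr hβr hαβ
    have hsum := D.inversions_add hl.1 hα hβ hαβ
    obtain ⟨l', h1, h2, h3, h4⟩ := descent hN hl hs hα
    have hr := reduced_left h1
    have hαβne : α ≠ β := by
      rintro rfl
      rw [bil_self hN hαr] at hb
      norm_num at hb
    have e1 : reflEnd α β = α + β := by
      rw [refl_bil hN hαr, bil_comm, hb]; simp [add_comm]
    have e2 : reflEnd α (α + β) = β := by
      rw [map_add, reflEnd_self (D.simple_ne hs), e1]; abel
    have i1 : α + β ∈ D.inversions (wordProd l') := by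
      have := inv_refl hN hl.1 hr.1 hs h4 hβ hαβne.symm
      rwa [e1] at this
    have i2 : β ∈ D.inversions (wordProd l') := by
      have := inv_refl hN hl.1 hr.1 hs h4 hsum (by
        simpa using D.ne_zero _ hβr)
      rwa [e2] at this
    have hαp : wordProd l' α ∈ D.pos := reduced_last_pos hN h1
    have hback : wordProd l = wordProd l' * reflEnd α := by
      rw [← h2, wordProd_append, wordProd_singleton]
    by_cases hβs : β ∈ D.simpleRoots
    · obtain ⟨l2, k1, k2, k3, k4⟩ := descent hN hr hβs i2
      have hr2 := reduced_left k1
      have i3 : α ∈ D.inversions (wordProd l2) := by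
        have := inv_refl hN hr.1 hr2.1 hβs k4 i1 (by simpa using D.ne_zero _ hαr)
        rwa [map_add, reflEnd_self (D.simple_ne hβs), refl_bil hN hβr, hb, neg_smul, one_smul,
          sub_neg_eq_add, add_neg_cancel_right] at this
      obtain ⟨l3, m1, m2, m3, m4⟩ := descent hN hr2 hs i3
      have he : wordProd (l3 ++ [α, β, α]) = wordProd l := by
        have : l3 ++ [α, β, α] = (l3 ++ [α]) ++ [β] ++ [α] := by simp
        rw [this, wordProd_append, wordProd_append, m2, ← wordProd_append, k2, ← wordProd_append,
          h2]
      refine ⟨l3 ++ [α, β, α], ⟨?_, ?_⟩, he, α, hs, β, hβs, (List.suffix_append _ _).isInfix⟩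
      · rw [D.isWord_append]
        refine ⟨(reduced_left m1).1, ?_⟩
        simp [IsWord, hs, hβs]
      · intro m hm hme
        have := hl.2 m hm (hme.trans he)
        simp
        omega
    · obtain ⟨d, hd, hdi⟩ := exists_descent hN hr i2
      have hdr := D.simple_root hd
      have hdα : d ≠ α := by
        rintro rfl
        exact hdi.2.2 hαp
      have hdβ : d ≠ β := by
        rintro rfl
        exact hβs hd
      have i3 := inv_refl hN hr.1 hl.1 hs hback hdi hdα
      rw [refl_bil hN hαr] at i3
      rcases simple_bil hN hd hs hdα with h0 | h0
      · rw [h0, zero_smul, sub_zero] at i3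
        exact step d hd i3 α β hα hβ hαβ hdα hdβ
      · rw [h0, neg_smul, one_smul, sub_neg_eq_add] at i3
        by_cases hdl : d ∈ D.inversions (wordProd l)
        · exact step d hd hdl α β hα hβ hαβ hdα hdβ
        have hdp : wordProd l d ∈ D.pos := by
          by_contra hcon
          exact hdl ((D.mem_inversions hl.1).2 ⟨hd.1, hcon⟩)
        have hdαr := D.pos_subset i3.1
        have hαd : α ≠ d + α := by
          simpa using D.simple_ne hd
        rcases bil_cases hN hβr hdr with ⟨h, _⟩ | ⟨h, _⟩ | h | h | h
        · exact absurd h.symm hdβ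
        · exfalso
          have h5 := hβ.1
          rw [h] at h5
          exact (D.pos_iff d hdr).1 hd.1 h5
        · exfalso
          have hx : bil N β (d + α) = -2 := by
            rw [bil_add_right, h, bil_comm N β α, hb]; norm_num
          rcases bil_cases hN hβr hdαr with ⟨_, h'⟩ | ⟨h', _⟩ | h' | h' | h'
          · rw [hx] at h'; norm_num at h'
          · have h5 := hβ.1
            rw [h'] at h5
            exact (D.pos_iff _ hdαr).1 i3.1 h5
          all_goals rw [hx] at h'; norm_num at h'
        · refine step α hs hα (d + α) β i3 hβ (add_root hN hdαr hβr ?_) hαd hαβne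
          rw [bil_add_left, bil_comm N d β, h, hb]; norm_num
        · have hm := sub_root hN hβr hdr h
          have hmp : β - d ∈ D.pos := by
            by_contra hcon
            rw [D.not_pos_iff hm] at hcon
            exact hd.2 ⟨β, hβ.1, _, hcon, by abel⟩
          have hmi : β - d ∈ D.inversions (wordProd l) := by
            rw [D.mem_inversions hl.1]
            refine ⟨hmp, fun hcon => hβ.2.2 ?_⟩
            have hy : wordProd l β = wordProd l (β - d) + wordProd l d := by
              rw [← map_add]; simp
            rw [hy]
            exact D.pos_add _ hcon _ hdp (by rw [← hy]; exact hβ.2.1)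
          refine step α hs hα (d + α) (β - d) i3 hmi ?_ hαd ?_
          · have : d + α + (β - d) = α + β := by abel
            rwa [this]
          · intro hcon
            have h7 : β = α + d := by rw [hcon]; abel
            rw [h7, bil_add_right, bil_self hN hαr, bil_comm N α d, h0] at hb
            norm_num at hb
  intro α β hα hβ hαβ
  obtain ⟨c, hc, hci⟩ := exists_descent hN hl hα
  by_cases h1 : c = α
  · exact key α β hα hβ hαβ (h1 ▸ hc)
  by_cases h2 : c = β
  · exact key β α hβ hα (by rwa [add_comm]) (h2 ▸ hc)
  exact step c hc hci α β hα hβ hαβ h1 h2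

lemma pattern_sum (hN : D.HasNorm N) {l : List V} (hl : D.IsReducedWord l) {a b : V}
    (h : [a, b, a] <:+: l) :
    ∃ α ∈ D.inversions (wordProd l), ∃ β ∈ D.inversions (wordProd l),
      α + β ∈ D.inversions (wordProd l) := by
  obtain ⟨s, t, rfl⟩ := h
  have hw := D.isWord_append.1 hl.1
  have hw2 := (D.isWord_append.1 hw.1).2
  have ha : a ∈ D.simpleRoots := hw2 a (by simp)
  have hb : b ∈ D.simpleRoots := hw2 b (by simp)
  have har := D.simple_root ha
  have hbr := D.simple_root hb
  have hs := (D.isWord_append.1 hw.1).1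
  have hshort : ∀ c ∈ D.simpleRoots, wordProd [a, b, a] ≠ reflEnd c := by
    intro c hc he
    have hh := hl.2 (s ++ [c] ++ t) (by
      simp only [D.isWord_append]
      exact ⟨⟨hs, by simpa [IsWord] using hc⟩, hw.2⟩)
      (by simp only [wordProd_append, wordProd_singleton, he])
    simp at hh
  have hab : a ≠ b := by
    rintro rfl
    apply hshort a ha
    simp only [wordProd_cons, wordProd_nil, mul_one]
    rw [reflEnd_mul_self (D.simple_ne ha), mul_one]
  have hbil : bil N a b = -1 := by
    rcases simple_bil hN ha hb hab with h0 | h0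
    · exfalso
      apply hshort b hb
      have hww : D.IsWord [a] := by simpa [IsWord] using ha
      have := D.wordProd_conj hww b
      rw [wordProd_singleton, refl_bil hN har b, bil_comm, h0, zero_smul, sub_zero] at this
      simp only [wordProd_cons, wordProd_nil, mul_one]
      rw [← mul_assoc, this, mul_assoc, reflEnd_mul_self (D.simple_ne ha), mul_one]
    · exact h0
  have eab : reflEnd a b = a + b := by
    rw [refl_bil hN har, bil_comm, hbil]; simp [add_comm]
  have eba : reflEnd b a = a + b := by
    rw [refl_bil hN hbr, hbil]; simp
  have r1 := reduced_inversion hN (D := D) (u := s ++ [a, b]) (c := a) (v := t) (by simpa using hl)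
  have r2 := reduced_inversion hN (D := D) (u := s ++ [a]) (c := b) (v := a :: t) (by simpa using hl)
  have r3 := reduced_inversion hN (D := D) (u := s) (c := a) (v := b :: a :: t) (by simpa using hl)
  have q1 : s ++ [a, b] ++ a :: t = s ++ [a, b, a] ++ t := by simp
  have q2 : s ++ [a] ++ b :: a :: t = s ++ [a, b, a] ++ t := by simp
  have q3 : s ++ a :: b :: a :: t = s ++ [a, b, a] ++ t := by simp
  rw [q1] at r1
  rw [q2] at r2
  rw [q3] at r3
  rw [List.reverse_cons, wordProd_append t.reverse, wordProd_singleton, Module.End.mul_apply, eab] at r2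
  rw [List.reverse_cons, List.reverse_cons, wordProd_append (t.reverse ++ [a]),
    wordProd_append t.reverse, wordProd_singleton,
    wordProd_singleton, Module.End.mul_apply, Module.End.mul_apply, eba, map_add (reflEnd a),
    reflEnd_self (D.simple_ne ha), eab, neg_add_cancel_left] at r3
  refine ⟨_, r1, _, r3, ?_⟩
  rw [← map_add]
  exact r2

lemma commutative_iff (hN : D.HasNorm N) (hsl : D.SimplyLaced) {w : Module.End ℝ V}
    (hw : D.InWeyl w) :
    D.Commutative w ↔ ∀ α ∈ D.inversions w, ∀ β ∈ D.inversions w, α + β ∉ D.inversions w := by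
  constructor
  · rintro ⟨_, hc⟩ α hα β hβ hαβ
    obtain ⟨l0, hl0, rfl⟩ := hw
    obtain ⟨l, hl, he⟩ := reduced_exists hl0
    rw [← he] at hα hβ hαβ
    obtain ⟨l', h1, h2, a, ha, b, hb, hab⟩ := sum_pattern hN _ l rfl hl α β hα hβ
      (D.pos_subset hαβ.1)
    refine hc l' h1 (h2.trans he) a ha b hb ?_ hab
    have := hsl a (D.simple_root ha) b (D.simple_root hb)
    rw [real_inner_self_eq_norm_sq, real_inner_self_eq_norm_sq] at this
    exact (sq_le_sq₀ (norm_nonneg _) (norm_nonneg _)).1 this.le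
  · intro h
    refine ⟨hw, ?_⟩
    rintro l hl rfl a ha b hb _ hab
    obtain ⟨α, hα, β, hβ, hαβ⟩ := pattern_sum hN hl hab
    exact h α hα β hβ hαβ

/-- There are no four orthogonal inversions whose half sum is a root, for an abelian
inversion set. -/
lemma no_four (hN : D.HasNorm N) {l : List V} (hl : D.IsWord l)
    (hab : ∀ α ∈ D.inversions (wordProd l), ∀ β ∈ D.inversions (wordProd l),
      α + β ∉ D.inversions (wordProd l))
    {θ a b c d : V} (hθ : θ ∈ D.roots)
    (ha : a ∈ D.inversions (wordProd l)) (hb : b ∈ D.inversions (wordProd l))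
    (hc : c ∈ D.inversions (wordProd l)) (hd : d ∈ D.inversions (wordProd l))
    (h1 : bil N a b = 0) (h2 : bil N a c = 0) (h3 : bil N a d = 0) (h4 : bil N b c = 0)
    (h5 : bil N b d = 0) (h6 : bil N c d = 0)
    (ta : bil N θ a = 1) (tb : bil N θ b = 1) (tc : bil N θ c = 1) (td : bil N θ d = 1)
    (hsum : θ + θ = a + b + c + d) : False := by
  have har := D.pos_subset ha.1
  have hbr := D.pos_subset hb.1
  have hcr := D.pos_subset hc.1
  have hdr := D.pos_subset hd.1
  -- a general closure argument
  have gen : ∀ P : Set V, (∀ x ∈ P, ∀ y ∈ P, x + y ∈ D.roots → x + y ∈ P) →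
      ∀ x ∈ D.roots, ∀ y ∈ D.roots, ∀ z ∈ D.roots, bil N x y = -1 → bil N x z = -1 →
      bil N y z = 0 → x ∈ P → y ∈ P → z ∈ P → x + y + z ∈ D.roots ∧ x + y + z ∈ P := by
    intro P hP x hx y hy z hz hxy hxz hyz px py pz
    have r1 := add_root hN hx hy hxy
    have r2 := add_root hN r1 hz (by rw [bil_add_left, hxz, hyz]; norm_num)
    exact ⟨r2, hP _ (hP _ px _ py r1) _ pz r2⟩
  let Q : Set V := {x | x ∈ D.roots ∧ wordProd l x ∉ D.pos}
  have hQ : ∀ x ∈ Q, ∀ y ∈ Q, x + y ∈ D.roots → x + y ∈ Q := by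
    rintro x ⟨hx, hx'⟩ y ⟨hy, hy'⟩ hxy
    refine ⟨hxy, ?_⟩
    have hr := D.wordProd_mem hl hxy
    rw [D.not_pos_iff (D.wordProd_mem hl hx)] at hx'
    rw [D.not_pos_iff (D.wordProd_mem hl hy)] at hy'
    rw [D.not_pos_iff hr]
    have e : -(wordProd l (x + y)) = -wordProd l x + -wordProd l y := by rw [map_add]; abel
    rw [e]
    refine D.pos_add _ hx' _ hy' ?_
    rw [← e]
    exact D.neg_mem hr
  have aQ : a ∈ Q := ⟨har, ha.2.2⟩
  have bQ : b ∈ Q := ⟨hbr, hb.2.2⟩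
  have cQ : c ∈ Q := ⟨hcr, hc.2.2⟩
  have dQ : d ∈ Q := ⟨hdr, hd.2.2⟩
  -- positivity and negativity of `θ`
  have hθP : ∀ P : Set V, (∀ x ∈ P, ∀ y ∈ P, x + y ∈ D.roots → x + y ∈ P) →
      a ∈ P → b ∈ P → c ∈ P → d ∈ P → -θ ∈ P → θ ∈ P := by
    intro P hP pa pb pc pd pt
    obtain ⟨r1, p1⟩ := gen P hP (-θ) (D.neg_mem hθ) a har b hbr (by rw [bil_neg_left, ta])
      (by rw [bil_neg_left, tb]) h1 pt pa pb
    obtain ⟨r2, p2⟩ := gen P hP (-θ + a + b) r1 c hcr d hdr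
      (by rw [bil_add_left, bil_add_left, bil_neg_left, tc, h2, h4]; norm_num)
      (by rw [bil_add_left, bil_add_left, bil_neg_left, td, h3, h5]; norm_num) h6 p1 pc pd
    have e : -θ + a + b + c + d = θ := by
      have : -θ + a + b + c + d = -θ + (a + b + c + d) := by abel
      rw [this, ← hsum]; abel
    rwa [e] at p2
  have hθpos : θ ∈ D.pos := by
    by_contra hcon
    exact hcon (hθP D.pos D.pos_add ha.1 hb.1 hc.1 hd.1 ((D.not_pos_iff hθ).1 hcon))
  have hθQ : θ ∈ Q := by
    by_contra hcon
    refine hcon (hθP Q hQ aQ bQ cQ dQ ⟨D.neg_mem hθ, ?_⟩)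
    have : wordProd l θ ∈ D.pos := by
      by_contra h'
      exact hcon ⟨hθ, h'⟩
    rw [map_neg]
    exact (D.pos_iff _ (D.pos_subset this)).1 this
  have hθi : θ ∈ D.inversions (wordProd l) := (D.mem_inversions hl).2 ⟨hθpos, hθQ.2⟩
  -- the signs of `θ - x` are preserved by `w`
  have sgn : ∀ x ∈ D.inversions (wordProd l), bil N θ x = 1 →
      (θ - x ∈ D.pos ↔ θ - x ∉ Q) := by
    intro x hx hb
    have hr := sub_root hN hθ (D.pos_subset hx.1) hb
    constructor
    · intro hp hq
      have := hab x hx (θ - x) ((D.mem_inversions hl).2 ⟨hp, hq.2⟩)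
      rw [add_sub_cancel] at this
      exact this hθi
    · intro hq
      by_contra hp
      rw [D.not_pos_iff hr] at hp
      have hwp : wordProd l (θ - x) ∈ D.pos := by
        by_contra h'
        exact hq ⟨hr, h'⟩
      have := hab θ hθi (-(θ - x)) ((D.mem_inversions hl).2 ⟨hp, by
        rw [map_neg]
        exact (D.pos_iff _ (D.pos_subset hwp)).1 hwp⟩)
      have e : θ + -(θ - x) = x := by abel
      rw [e] at this
      exact this hx
  -- at most one of the differences is negative
  have two : ∀ P : Set V, (∀ x ∈ P, ∀ y ∈ P, x + y ∈ D.roots → x + y ∈ P) →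
      ∀ x ∈ D.roots, ∀ y ∈ D.roots, ∀ z ∈ D.roots, ∀ t ∈ D.roots, bil N θ y = 1 →
      bil N θ z = 1 → bil N θ t = 1 → bil N y z = 0 →
      bil N y t = 0 → bil N z t = 0 → z ∈ P → t ∈ P → θ + θ = x + y + z + t →
      -(θ - y) ∈ P → θ - x ∈ P := by
    intro P hP x hx y hy z hz t ht by1 bz1 bt1 yz yt zt pz pt hs hm
    obtain ⟨_, p⟩ := gen P hP (-(θ - y)) (D.neg_mem (sub_root hN hθ hy by1)) z hz t ht
      (by rw [bil_neg_left, bil_sub_left, bz1, yz]; norm_num)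
      (by rw [bil_neg_left, bil_sub_left, bt1, yt]; norm_num) zt hm pz pt
    have e : -(θ - y) + z + t = θ - x := by
      have : -(θ - y) + z + t = (x + y + z + t) - θ - x := by abel
      rw [this, ← hs]; abel
    rwa [e] at p
  have tP : ∀ x ∈ D.inversions (wordProd l), ∀ y ∈ D.inversions (wordProd l),
      ∀ z ∈ D.inversions (wordProd l), ∀ t ∈ D.inversions (wordProd l), bil N θ x = 1 →
      bil N θ y = 1 →
      bil N θ z = 1 → bil N θ t = 1 → bil N y z = 0 →
      bil N y t = 0 → bil N z t = 0 → θ + θ = x + y + z + t →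
      (θ - y ∉ D.pos → θ - x ∈ D.pos) ∧ (θ - y ∉ Q → θ - x ∈ Q) := by
    intro x hx y hy z hz t ht bx1 by1 bz1 bt1 yz yt zt hs
    have hyr := sub_root hN hθ (D.pos_subset hy.1) by1
    refine ⟨fun h => ?_, fun h => ?_⟩
    · exact two D.pos D.pos_add x (D.pos_subset hx.1) y (D.pos_subset hy.1) z (D.pos_subset hz.1)
        t (D.pos_subset ht.1) by1 bz1 bt1 yz yt zt hz.1 ht.1 hs ((D.not_pos_iff hyr).1 h)
    · refine two Q hQ x (D.pos_subset hx.1) y (D.pos_subset hy.1) z (D.pos_subset hz.1)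
        t (D.pos_subset ht.1) by1 bz1 bt1 yz yt zt ⟨D.pos_subset hz.1, hz.2.2⟩
        ⟨D.pos_subset ht.1, ht.2.2⟩ hs ⟨D.neg_mem hyr, ?_⟩
      have : wordProd l (θ - y) ∈ D.pos := by
        by_contra h'
        exact h ⟨hyr, h'⟩
      rw [map_neg]
      exact (D.pos_iff _ (D.pos_subset this)).1 this
  have sa := sgn a ha ta
  have sb := sgn b hb tb
  have sc := sgn c hc tc
  have tab := tP a ha b hb c hc d hd ta tb tc td h4 h5 h6 hsum
  have tac := tP a ha c hc b hb d hd ta tc tb td (by rw [bil_comm, h4]) h6 h5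
    (by rw [hsum]; abel)
  have tbc := tP b hb c hc a ha d hd tb tc ta td (by rw [bil_comm, h2]) h6 h3
    (by rw [hsum]; abel)
  tauto

end comb2

end RootSystemData

namespace LieRootData

section lie

variable {L : Type*} [LieRing L] [LieAlgebra ℂ L] (D : LieRootData V L)

/-- In a root `sl₂`, the square of the adjoint action of a root vector is non-zero on the opposite
root space. -/
lemma exists_lie_lie_ne {γ : V} (hγ : γ ∈ D.roots) {c : L} (hc : c ∈ D.rs γ) (hc0 : c ≠ 0) :
    ∃ f ∈ D.rs (-γ), ⁅c, ⁅c, f⁆⁆ ≠ 0 := by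
  by_contra! hcon
  haveI := D.finiteDim
  haveI := D.isSimple
  haveI := D.isCartan
  let S : Submodule ℂ L := ⨆ β ∈ D.roots \ {γ}, D.rs β
  have hS : ∀ z : L, ⁅c, ⁅c, z⁆⁆ ∈ S := by
    let T : L →ₗ[ℂ] L := (LieAlgebra.ad ℂ L c) ∘ₗ (LieAlgebra.ad ℂ L c)
    have hT : (⊤ : Submodule ℂ L) ≤ S.comap T := by
      rw [← D.sup_eq_top]
      refine sup_le ?_ (iSup₂_le ?_)
      · intro h hh
        obtain ⟨k, hk⟩ := D.weight_vec γ hγ h hh c hc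
        have : ⁅c, h⁆ = -(k • c) := by rw [← lie_skew, hk]
        simp [T, this]
      · intro δ hδ z hz
        show ⁅c, ⁅c, z⁆⁆ ∈ S
        by_cases h1 : γ + δ = 0
        · have : δ = -γ := (neg_eq_of_add_eq_zero_right h1).symm
          rw [this] at hz
          rw [hcon z hz]
          exact S.zero_mem
        by_cases h2 : γ + δ ∈ D.roots
        · have hm := D.bracket_mem γ hγ δ hδ h2 c hc z hz
          by_cases h3 : γ + (γ + δ) ∈ D.roots
          · have hm2 := D.bracket_mem γ hγ _ h2 h3 c hc _ hm
            have hle : D.rs (γ + (γ + δ)) ≤ S :=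
              le_iSup₂_of_le (f := fun β (_ : β ∈ D.roots \ {γ}) => D.rs β) (γ + (γ + δ))
                ⟨h3, by simpa using h1⟩ le_rfl
            exact hle hm2
          · have h4 : γ + (γ + δ) ≠ 0 := by
              intro h4
              have : δ = (-2 : ℝ) • γ := by
                have : δ = -(γ + γ) := by
                  rw [← add_assoc] at h4
                  exact (neg_eq_of_add_eq_zero_right h4).symm
                rw [this, neg_smul, two_smul]
              rw [this] at hδ
              rcases D.reduced γ hγ _ hδ with h | h <;> norm_num at h
            rw [D.bracket_eq_zero γ hγ _ h2 h3 h4 c hc _ hm]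
            exact S.zero_mem
        · rw [D.bracket_eq_zero γ hγ δ hδ h2 h1 c hc z hz, lie_zero]
          exact S.zero_mem
    intro z
    exact hT (Submodule.mem_top : z ∈ ⊤)
  have hind := D.indep γ hγ
  -- the weight of `c`
  have hw : ∀ h : D.cartan, ∃ k : ℂ, ⁅(h : L), c⁆ = k • c := fun h =>
    D.weight_vec γ hγ h h.2 c hc
  choose χ hχ using hw
  have hcw : c ∈ LieAlgebra.rootSpace D.cartan χ := by
    apply LieModule.weightSpace_le_genWeightSpace
    rw [LieModule.mem_weightSpace]
    intro h
    exact hχ h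
  let α : LieModule.Weight ℂ D.cartan L := ⟨χ, fun hbot => hc0 (by
    have h := hcw
    rw [LieAlgebra.rootSpace, hbot] at h
    simpa using h)⟩
  have hα : α.IsNonZero := by
    intro h0
    have h0' : χ = 0 := h0
    rw [h0', LieAlgebra.rootSpace_zero_eq] at hcw
    have hcH : c ∈ D.cartan := hcw
    have : c ∈ D.rs γ ⊓ (D.cartan.toSubmodule ⊔ S) :=
      ⟨hc, (le_sup_left : D.cartan.toSubmodule ≤ D.cartan.toSubmodule ⊔ S) hcH⟩
    rw [hind] at this
    exact hc0 (by simpa using this)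
  obtain ⟨h, e, f, ht, he, hf⟩ := LieAlgebra.IsKilling.exists_isSl2Triple_of_weight_isNonZero hα
  have hcα : c ∈ LieAlgebra.rootSpace D.cartan α := hcw
  obtain ⟨t, ht'⟩ := (finrank_eq_one_iff_of_nonzero' (⟨c, hcα⟩ : LieAlgebra.rootSpace D.cartan α)
    (by simpa using hc0)).mp (LieAlgebra.IsKilling.finrank_rootSpace_eq_one α hα) ⟨e, he⟩
  have hte : t • c = e := by simpa using congrArg Subtype.val ht'
  have h1 : ⁅e, ⁅e, f⁆⁆ = -((2 : ℂ) • e) := by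
    rw [ht.lie_e_f, ← lie_skew, ht.lie_h_e_nsmul, two_smul, two_smul]
  have h2 : ⁅e, ⁅e, f⁆⁆ ∈ S := by
    rw [← hte, smul_lie, smul_lie, lie_smul]
    exact S.smul_mem _ (S.smul_mem _ (hS f))
  rw [h1] at h2
  have h3 : e ∈ S := by
    have := S.smul_mem (-(1 / 2 : ℂ)) h2
    simpa [smul_smul] using this
  have : e ∈ D.rs γ ⊓ (D.cartan.toSubmodule ⊔ S) :=
    ⟨hte ▸ (D.rs γ).smul_mem t hc, (le_sup_right : S ≤ D.cartan.toSubmodule ⊔ S) h3⟩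
  rw [hind] at this
  exact ht.e_ne_zero (by simpa using this)

lemma ad_four_sl3 {a b c f : L} (hc : ⁅a, b⁆ = c) (hac : ⁅a, c⁆ = 0) (hbc : ⁅b, c⁆ = 0)
    (haf : ⁅a, ⁅a, f⁆⁆ = 0) (hbf : ⁅b, ⁅b, f⁆⁆ = 0) :
    ⁅a + b, ⁅a + b, ⁅a + b, ⁅a + b, f⁆⁆⁆⁆ = -((3 : ℂ) • ⁅c, ⁅c, f⁆⁆) := by
  have e1 : ∀ z : L, ⁅a, ⁅b, z⁆⁆ = ⁅b, ⁅a, z⁆⁆ + ⁅c, z⁆ := by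
    intro z
    rw [leibniz_lie, hc, add_comm]
  have e2 : ∀ z : L, ⁅a, ⁅c, z⁆⁆ = ⁅c, ⁅a, z⁆⁆ := by
    intro z
    rw [leibniz_lie, hac, zero_lie, zero_add]
  have e3 : ∀ z : L, ⁅b, ⁅c, z⁆⁆ = ⁅c, ⁅b, z⁆⁆ := by
    intro z
    rw [leibniz_lie, hbc, zero_lie, zero_add]
  have e4 : ⁅b, ⁅b, ⁅a, f⁆⁆⁆ = -((2 : ℂ) • ⁅c, ⁅b, f⁆⁆) := by
    have h : ⁅a, ⁅b, ⁅b, f⁆⁆⁆ = 0 := by rw [hbf, lie_zero]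
    rw [e1, e1, lie_add, e3] at h
    rw [two_smul, eq_neg_iff_add_eq_zero, ← h]
    abel
  simp only [add_lie, lie_add, e1, e2, e3, e4, haf, hbf, lie_zero, lie_neg, lie_smul]
  module

lemma exists_ne {α : V} (hα : α ∈ D.roots) : ∃ x ∈ D.rs α, x ≠ 0 := by
  have h := D.rs_dim α hα
  have : D.rs α ≠ ⊥ := by
    intro h0
    rw [h0] at h
    simp at h
  exact (Submodule.ne_bot_iff _).1 this

lemma rs_le {S : Set V} {α : V} (hα : α ∈ S) : D.rs α ≤ D.aSubspace S :=
  le_iSup₂_of_le (f := fun β (_ : β ∈ S) => D.rs β) α hα le_rfl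

lemma aSub_induction {S : Set V} {p : L → Prop} (h0 : p 0) (hadd : ∀ x y, p x → p y → p (x + y))
    (hsmul : ∀ (k : ℂ) x, p x → p (k • x)) (hrs : ∀ α ∈ S, ∀ x ∈ D.rs α, p x) :
    ∀ x ∈ D.aSubspace S, p x := by
  intro x hx
  let K : Submodule ℂ L :=
    { carrier := {x | p x}
      add_mem' := fun {a b} ha hb => hadd a b ha hb
      zero_mem' := h0
      smul_mem' := fun k x hx => hsmul k x hx }
  have : D.aSubspace S ≤ K := iSup₂_le hrs
  exact this hx

variable {N : ℝ}

open RootSystemData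

lemma not_spherical (hN : D.toRootSystemData.HasNorm N) {S : Set V} {α β : V} (hα : α ∈ S)
    (hβ : β ∈ S) (hαr : α ∈ D.roots) (hβr : β ∈ D.roots) (hαβ : α + β ∈ D.roots) :
    ¬ IsSphericalSubspace (D.aSubspace S) := by
  intro hs
  have hb := bil_of_add_root hN hαr hβr hαβ
  have hsix : ∀ x y : V, x ∈ D.roots → y ∈ D.roots → bil N x y = 1 → x + y ∉ D.roots ∧ x + y ≠ 0 := by
    intro x y hx hy hxy
    constructor
    · intro h
      have := bil_of_add_root hN hx hy h
      rw [hxy] at this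
      norm_num at this
    · intro h
      have := bil_add_left N x y y
      rw [h, hxy, bil_self hN hy] at this
      simp [bil] at this
      norm_num at this
  obtain ⟨a, ha, ha0⟩ := D.exists_ne hαr
  obtain ⟨b, hbm, hb0⟩ := D.exists_ne hβr
  have hcm := D.bracket_mem α hαr β hβr hαβ a ha b hbm
  have hc0 := D.bracket_ne_zero α hαr β hβr hαβ a ha ha0 b hbm hb0
  obtain ⟨f, hf, hff⟩ := D.exists_lie_lie_ne hαβ hcm hc0
  have haα : bil N α (α + β) = 1 := by
    rw [bil_add_right, bil_self hN hαr, hb]; norm_num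
  have hbβ : bil N β (α + β) = 1 := by
    rw [bil_add_right, bil_self hN hβr, bil_comm, hb]; norm_num
  have hac : ⁅a, ⁅a, b⁆⁆ = 0 :=
    D.bracket_eq_zero α hαr _ hαβ (hsix _ _ hαr hαβ haα).1 (hsix _ _ hαr hαβ haα).2 a ha _ hcm
  have hbc : ⁅b, ⁅a, b⁆⁆ = 0 :=
    D.bracket_eq_zero β hβr _ hαβ (hsix _ _ hβr hαβ hbβ).1 (hsix _ _ hβr hαβ hbβ).2 b hbm _ hcm
  have hnr := D.neg_mem hαβ
  have ea : α + -(α + β) = -β := by abel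
  have eb : β + -(α + β) = -α := by abel
  have hnα := D.neg_mem hαr
  have hnβ := D.neg_mem hβr
  have haf1 := D.bracket_mem α hαr _ hnr (by rw [ea]; exact hnβ) a ha f hf
  have hbf1 := D.bracket_mem β hβr _ hnr (by rw [eb]; exact hnα) b hbm f hf
  rw [ea] at haf1
  rw [eb] at hbf1
  have k1 := hsix α (-β) hαr hnβ (by rw [bil_neg_right, hb]; norm_num)
  have k2 := hsix β (-α) hβr hnα (by rw [bil_neg_right, bil_comm, hb]; norm_num)
  have haf := D.bracket_eq_zero α hαr _ hnβ k1.1 k1.2 a ha _ haf1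
  have hbf := D.bracket_eq_zero β hβr _ hnα k2.1 k2.2 b hbm _ hbf1
  have key := ad_four_sl3 rfl hac hbc haf hbf
  have h4 := hs (a + b) (add_mem (D.rs_le hα ha) (D.rs_le hβ hbm))
  have h5 := LinearMap.congr_fun h4 f
  simp only [pow_succ, pow_zero, one_mul, Module.End.mul_apply, LieAlgebra.ad_apply,
    LinearMap.zero_apply] at h5
  rw [key, neg_eq_zero, smul_eq_zero] at h5
  rcases h5 with h5 | h5
  · norm_num at h5
  · exact hff h5

lemma spherical (hN : D.toRootSystemData.HasNorm N) {l : List V}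
    (hl : D.toRootSystemData.IsWord l)
    (hab : ∀ α ∈ D.toRootSystemData.inversions (wordProd l),
      ∀ β ∈ D.toRootSystemData.inversions (wordProd l),
      α + β ∉ D.toRootSystemData.inversions (wordProd l)) :
    IsSphericalSubspace (D.aSubspace (D.toRootSystemData.inversions (wordProd l))) := by
  set Φ := D.toRootSystemData.inversions (wordProd l) with hΦ
  have hr : ∀ α ∈ Φ, α ∈ D.roots := fun α hα => D.pos_subset hα.1
  have comm : ∀ α ∈ Φ, ∀ β ∈ Φ, ∀ x ∈ D.rs α, ∀ y ∈ D.rs β, ⁅x, y⁆ = 0 := by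
    intro α hα β hβ x hx y hy
    refine D.bracket_eq_zero α (hr α hα) β (hr β hβ) ?_ ?_ x hx y hy
    · intro h
      exact hab α hα β hβ (D.toRootSystemData.inversions_add hl hα hβ h)
    · intro h
      have h1 : α = -β := eq_neg_of_add_eq_zero_left h
      have h2 := hα.1
      rw [h1] at h2
      exact (D.pos_iff β (hr β hβ)).1 hβ.1 h2
  have sw : ∀ α ∈ Φ, ∀ β ∈ Φ, ∀ x ∈ D.rs α, ∀ y ∈ D.rs β, ∀ z : L,
      ⁅x, ⁅y, z⁆⁆ = ⁅y, ⁅x, z⁆⁆ := by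
    intro α hα β hβ x hx y hy z
    rw [leibniz_lie, comm α hα β hβ x hx y hy, zero_lie, zero_add]
  have kill : ∀ α ∈ Φ, ∀ β ∈ Φ, ∀ x ∈ D.rs α, ∀ y ∈ D.rs β, ∀ h ∈ D.cartan,
      ⁅x, ⁅y, h⁆⁆ = 0 := by
    intro α hα β hβ x hx y hy h hh
    obtain ⟨k, hk⟩ := D.weight_vec β (hr β hβ) h hh y hy
    rw [← lie_skew y h, hk, lie_neg, lie_smul, comm α hα β hβ x hx y hy, smul_zero, neg_zero]
  have step : ∀ α ∈ Φ, ∀ β ∈ Φ, ∀ x ∈ D.rs α, ∀ x' ∈ D.rs β, ∀ δ ∈ D.roots, ∀ y ∈ D.rs δ,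
      (∀ μ ∈ Φ, ∀ ν ∈ Φ, ∀ u ∈ D.rs μ, ∀ v ∈ D.rs ν, ⁅u, ⁅v, ⁅x, ⁅x', y⁆⁆⁆⁆ = 0) ∨
      (bil N δ α = -1 ∧ bil N δ β = -1 ∧ bil N α β = 0) := by
    intro α hα β hβ x hx x' hx' δ hδ y hy
    have hαr := hr α hα
    have hβr := hr β hβ
    by_cases c1 : β + δ = 0
    · left
      have e : δ = -β := (neg_eq_of_add_eq_zero_right c1).symm
      rw [e] at hy
      intro μ hμ ν hν u hu v hv
      rw [kill ν hν α hα v hv x hx _ (D.bracket_cartan_mem β hβr x' hx' y hy), lie_zero]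
    by_cases c2 : α + δ = 0
    · left
      have e : δ = -α := (neg_eq_of_add_eq_zero_right c2).symm
      rw [e] at hy
      intro μ hμ ν hν u hu v hv
      rw [sw α hα β hβ x hx x' hx',
        kill ν hν β hβ v hv x' hx' _ (D.bracket_cartan_mem α hαr x hx y hy), lie_zero]
    by_cases c3 : β + δ ∈ D.roots
    swap
    · left
      intro μ hμ ν hν u hu v hv
      rw [D.bracket_eq_zero β hβr δ hδ c3 c1 x' hx' y hy]
      simp
    by_cases c4 : α + δ ∈ D.roots
    swap
    · left
      intro μ hμ ν hν u hu v hv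
      rw [sw α hα β hβ x hx x' hx', D.bracket_eq_zero α hαr δ hδ c4 c2 x hx y hy]
      simp
    have hm := D.bracket_mem β hβr δ hδ c3 x' hx' y hy
    by_cases c5 : α + (β + δ) = 0
    · left
      have e : β + δ = -α := (neg_eq_of_add_eq_zero_right c5).symm
      rw [e] at hm
      intro μ hμ ν hν u hu v hv
      exact kill μ hμ ν hν u hu v hv _ (D.bracket_cartan_mem α hαr x hx _ hm)
    by_cases c6 : α + (β + δ) ∈ D.roots
    swap
    · left
      intro μ hμ ν hν u hu v hv
      rw [D.bracket_eq_zero α hαr _ c3 c6 c5 x hx _ hm]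
      simp
    right
    have b1 := bil_of_add_root hN hβr hδ c3
    have b2 := bil_of_add_root hN hαr hδ c4
    have b3 := bil_of_add_root hN hαr c3 c6
    rw [bil_add_right, b2] at b3
    refine ⟨by rw [bil_comm, b2], by rw [bil_comm, b1], by linarith⟩
  have basic : ∀ α₁ ∈ Φ, ∀ x₁ ∈ D.rs α₁, ∀ α₂ ∈ Φ, ∀ x₂ ∈ D.rs α₂, ∀ α₃ ∈ Φ, ∀ x₃ ∈ D.rs α₃,
      ∀ α₄ ∈ Φ, ∀ x₄ ∈ D.rs α₄, ∀ y : L, ⁅x₁, ⁅x₂, ⁅x₃, ⁅x₄, y⁆⁆⁆⁆ = 0 := by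
    intro α₁ h₁ x₁ m₁ α₂ h₂ x₂ m₂ α₃ h₃ x₃ m₃ α₄ h₄ x₄ m₄
    let T : L →ₗ[ℂ] L := (LieAlgebra.ad ℂ L x₁) ∘ₗ (LieAlgebra.ad ℂ L x₂) ∘ₗ
      (LieAlgebra.ad ℂ L x₃) ∘ₗ (LieAlgebra.ad ℂ L x₄)
    have hT : (⊤ : Submodule ℂ L) ≤ LinearMap.ker T := by
      rw [← D.sup_eq_top]
      refine sup_le ?_ (iSup₂_le ?_)
      · intro h hh
        show ⁅x₁, ⁅x₂, ⁅x₃, ⁅x₄, h⁆⁆⁆⁆ = 0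
        rw [kill α₃ h₃ α₄ h₄ x₃ m₃ x₄ m₄ h hh]
        simp
      · intro δ hδ y hy
        show ⁅x₁, ⁅x₂, ⁅x₃, ⁅x₄, y⁆⁆⁆⁆ = 0
        have s12 := sw α₁ h₁ α₂ h₂ x₁ m₁ x₂ m₂
        have s13 := sw α₁ h₁ α₃ h₃ x₁ m₁ x₃ m₃
        have s14 := sw α₁ h₁ α₄ h₄ x₁ m₁ x₄ m₄
        have s23 := sw α₂ h₂ α₃ h₃ x₂ m₂ x₃ m₃
        have s24 := sw α₂ h₂ α₄ h₄ x₂ m₂ x₄ m₄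
        have s34 := sw α₃ h₃ α₄ h₄ x₃ m₃ x₄ m₄
        rcases step α₃ h₃ α₄ h₄ x₃ m₃ x₄ m₄ δ hδ y hy with k | ⟨b3, b4, b34⟩
        · exact k α₁ h₁ α₂ h₂ x₁ m₁ x₂ m₂
        rcases step α₂ h₂ α₄ h₄ x₂ m₂ x₄ m₄ δ hδ y hy with k | ⟨b2, _, b24⟩
        · rw [s23]
          exact k α₁ h₁ α₃ h₃ x₁ m₁ x₃ m₃
        rcases step α₂ h₂ α₃ h₃ x₂ m₂ x₃ m₃ δ hδ y hy with k | ⟨_, _, b23⟩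
        · rw [s34, s24]
          exact k α₁ h₁ α₄ h₄ x₁ m₁ x₄ m₄
        rcases step α₁ h₁ α₄ h₄ x₁ m₁ x₄ m₄ δ hδ y hy with k | ⟨b1, _, b14⟩
        · rw [s12, s13]
          exact k α₂ h₂ α₃ h₃ x₂ m₂ x₃ m₃
        rcases step α₁ h₁ α₃ h₃ x₁ m₁ x₃ m₃ δ hδ y hy with k | ⟨_, _, b13⟩
        · rw [s34, s12, s14]
          exact k α₂ h₂ α₄ h₄ x₂ m₂ x₄ m₄
        rcases step α₁ h₁ α₂ h₂ x₁ m₁ x₂ m₂ δ hδ y hy with k | ⟨_, _, b12⟩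
        · rw [s23, s24, s13, s14]
          exact k α₃ h₃ α₄ h₄ x₃ m₃ x₄ m₄
        exfalso
        have hz : -δ + -δ - (α₁ + α₂ + α₃ + α₄) = 0 := by
          apply bil_self_eq_zero hN.1
          simp only [bil_sub_left, bil_sub_right, bil_add_left, bil_add_right, bil_neg_left,
            bil_neg_right, bil_self hN hδ, bil_self hN (hr _ h₁), bil_self hN (hr _ h₂),
            bil_self hN (hr _ h₃), bil_self hN (hr _ h₄), b1, b2, b3, b4, b12, b13, b14, b23, b24,
            b34, bil_comm N α₁ δ, bil_comm N α₂ δ, bil_comm N α₃ δ, bil_comm N α₄ δ,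
            bil_comm N α₂ α₁, bil_comm N α₃ α₁, bil_comm N α₄ α₁, bil_comm N α₃ α₂,
            bil_comm N α₄ α₂, bil_comm N α₄ α₃]
          norm_num
        refine no_four hN hl hab (D.neg_mem hδ) h₁ h₂ h₃ h₄ b12 b13 b14 b23 b24 b34 ?_ ?_ ?_ ?_
          (sub_eq_zero.1 hz)
        all_goals rw [bil_neg_left]; linarith
    intro y
    exact hT (Submodule.mem_top : y ∈ ⊤)
  have s4 : ∀ α₁ ∈ Φ, ∀ x₁ ∈ D.rs α₁, ∀ α₂ ∈ Φ, ∀ x₂ ∈ D.rs α₂, ∀ α₃ ∈ Φ, ∀ x₃ ∈ D.rs α₃,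
      ∀ x₄ ∈ D.aSubspace Φ, ∀ y : L, ⁅x₁, ⁅x₂, ⁅x₃, ⁅x₄, y⁆⁆⁆⁆ = 0 := by
    intro α₁ h₁ x₁ m₁ α₂ h₂ x₂ m₂ α₃ h₃ x₃ m₃
    refine D.aSub_induction (by simp) (fun x x' hx hx' y => ?_) (fun k x hx y => ?_)
      (basic α₁ h₁ x₁ m₁ α₂ h₂ x₂ m₂ α₃ h₃ x₃ m₃)
    · simp only [add_lie, lie_add, hx, hx', add_zero]
    · simp only [smul_lie, lie_smul, hx, smul_zero]
  have s3 : ∀ α₁ ∈ Φ, ∀ x₁ ∈ D.rs α₁, ∀ α₂ ∈ Φ, ∀ x₂ ∈ D.rs α₂, ∀ x₃ ∈ D.aSubspace Φ,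
      ∀ x₄ ∈ D.aSubspace Φ, ∀ y : L, ⁅x₁, ⁅x₂, ⁅x₃, ⁅x₄, y⁆⁆⁆⁆ = 0 := by
    intro α₁ h₁ x₁ m₁ α₂ h₂ x₂ m₂
    refine D.aSub_induction (by simp) (fun x x' hx hx' z hz y => ?_) (fun k x hx z hz y => ?_)
      (s4 α₁ h₁ x₁ m₁ α₂ h₂ x₂ m₂)
    · simp only [add_lie, lie_add, hx z hz, hx' z hz, add_zero]
    · simp only [smul_lie, lie_smul, hx z hz, smul_zero]
  have s2 : ∀ α₁ ∈ Φ, ∀ x₁ ∈ D.rs α₁, ∀ x₂ ∈ D.aSubspace Φ, ∀ x₃ ∈ D.aSubspace Φ,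
      ∀ x₄ ∈ D.aSubspace Φ, ∀ y : L, ⁅x₁, ⁅x₂, ⁅x₃, ⁅x₄, y⁆⁆⁆⁆ = 0 := by
    intro α₁ h₁ x₁ m₁
    refine D.aSub_induction (by simp) (fun x x' hx hx' u hu z hz y => ?_)
      (fun k x hx u hu z hz y => ?_) (s3 α₁ h₁ x₁ m₁)
    · simp only [add_lie, lie_add, hx u hu z hz, hx' u hu z hz, add_zero]
    · simp only [smul_lie, lie_smul, hx u hu z hz, smul_zero]
  have s1 : ∀ x₁ ∈ D.aSubspace Φ, ∀ x₂ ∈ D.aSubspace Φ, ∀ x₃ ∈ D.aSubspace Φ,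
      ∀ x₄ ∈ D.aSubspace Φ, ∀ y : L, ⁅x₁, ⁅x₂, ⁅x₃, ⁅x₄, y⁆⁆⁆⁆ = 0 := by
    refine D.aSub_induction (by simp) (fun x x' hx hx' v hv u hu z hz y => ?_)
      (fun k x hx v hv u hu z hz y => ?_) s2
    · simp only [add_lie, hx v hv u hu z hz, hx' v hv u hu z hz, add_zero]
    · simp only [smul_lie, hx v hv u hu z hz, smul_zero]
  intro x hx
  ext y
  simp only [pow_succ, pow_zero, one_mul, Module.End.mul_apply, LieAlgebra.ad_apply,
    LinearMap.zero_apply]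
  exact s1 x hx x hx x hx x hx y

end lie

end LieRootData

/-- Suppose `Φ` is irreducible and simply laced, and let
`w ∈ W`. Then `w` is commutative — equivalently, the inversion set `Φ(w)`
contains no pair `α, β` with `α + β ∈ Φ(w)` — if and only if
`𝔞_w = ⊕_{α ∈ Φ(w)} 𝔤_α` is a spherical subspace of `𝔫`. -/
theorem simplyLaced_commutative_iff_spherical
    {V : Type*} [NormedAddCommGroup V] [InnerProductSpace ℝ V]
    {L : Type*} [LieRing L] [LieAlgebra ℂ L]
    (D : LieRootData V L)
    (hirr : D.toRootSystemData.IsIrreducible)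
    (hsl : D.toRootSystemData.SimplyLaced)
    (w : Module.End ℝ V) (hw : D.toRootSystemData.InWeyl w) :
    (D.toRootSystemData.Commutative w ↔
        ∀ α ∈ D.toRootSystemData.inversions w,
          ∀ β ∈ D.toRootSystemData.inversions w,
            α + β ∉ D.toRootSystemData.inversions w) ∧
      (D.toRootSystemData.Commutative w ↔
        IsSphericalSubspace (D.aSubspace (D.toRootSystemData.inversions w))) := by
  have hN : ∃ N : ℝ, D.toRootSystemData.HasNorm N := by
    obtain ⟨α, hα⟩ := hirr.1
    refine ⟨⟪α, α⟫, ?_, fun β hβ => hsl β hβ α hα⟩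
    exact real_inner_self_pos.2 (D.ne_zero α hα)
  obtain ⟨N, hN⟩ := hN
  have h1 := RootSystemData.commutative_iff hN hsl hw
  refine ⟨h1, h1.trans ?_⟩
  obtain ⟨l, hl, rfl⟩ := hw
  constructor
  · intro h
    exact D.spherical hN hl h
  · intro h α hα β hβ hαβ
    exact D.not_spherical hN hα hβ (D.pos_subset hα.1) (D.pos_subset hβ.1)
      (D.pos_subset hαβ.1) h
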